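/- The additive groups ℤ and ℤ × ℚ are elementarily equivalent as L_gp-structures: they satisfy exactly the same first-order sentences in the language of groups. -/

import Mathlib

open FirstOrder

/-- Function symbols of the first-order language of groups: a constant for the identity,
a unary symbol for inversion, and a binary symbol for multiplication. -/
inductive GroupFn : ℕ → Type
  | one : GroupFn 0
  | inv : GroupFn 1
  | mul : GroupFn 2

/-- The first-order language of groups. -/
def Lgp : Language := ⟨GroupFn, fun _ => Empty⟩

/-- Every group is an `Lgp`-structure in the natural way. -/
instance (priority := 100) groupLgpStructure (G : Type*) [Group G] : Lgp.Structure G where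
  funMap {_} f x :=
    match f with
    | .one => 1
    | .inv => (x 0)⁻¹
    | .mul => x 0 * x 1
  RelMap {_} r := Empty.elim r


/-- A group on which all nonzero integers act bijectively is a `ℚ`-vector space. -/
theorem exists_rat_module (D : Type) [AddCommGroup D]
    (h : ∀ n : ℤ, n ≠ 0 → Function.Bijective (fun x : D => n • x)) : Nonempty (Module ℚ D) := by
  have hl : IsLocalizedModule (nonZeroDivisors ℤ) (LinearMap.id : D →ₗ[ℤ] D) :=
    { map_units := fun y => (Module.End.isUnit_iff _).mpr (h y (nonZeroDivisors.ne_zero y.2))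
      surj := fun x => ⟨(x, 1), by simp⟩
      exists_of_eq := fun {x y} hxy => ⟨1, by simpa using hxy⟩ }
  exact ⟨IsLocalizedModule.module (nonZeroDivisors ℤ) LinearMap.id⟩

theorem absorb_rat_space (V W : Type) [AddCommGroup V] [AddCommGroup W] [Module ℚ V] [Module ℚ W]
    (hV : ¬ FiniteDimensional ℚ V) (hc : Cardinal.mk W ≤ Cardinal.mk V) :
    Nonempty (V ≃+ V × W) := by
  have hr : Cardinal.aleph0 ≤ Module.rank ℚ V := by
    by_contra hlt
    exact hV (Module.rank_lt_aleph0_iff.mp (not_le.mp hlt))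
  have hVr : Cardinal.mk V ≤ Module.rank ℚ V := by
    let b := Module.Basis.ofVectorSpace ℚ V
    have h1 := Cardinal.mk_congr b.repr.toEquiv
    have h2 := b.mk_eq_rank''
    rw [h1]
    have hinf : Infinite (Module.Basis.ofVectorSpaceIndex ℚ V) := by
      rw [Cardinal.infinite_iff, h2]; exact hr
    rw [Cardinal.mk_finsupp_of_infinite, h2]
    refine max_le le_rfl ?_
    simpa using hr
  have hW : Module.rank ℚ W ≤ Module.rank ℚ V := (rank_le_card ℚ W).trans (hc.trans hVr)
  have : Module.rank ℚ V = Module.rank ℚ (V × W) := by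
    rw [rank_prod', Cardinal.add_eq_left hr hW]
  obtain ⟨e⟩ := nonempty_linearEquiv_of_rank_eq this
  exact ⟨e.toAddEquiv⟩

theorem split_absorb (U V W : Type) [AddCommGroup U] [AddCommGroup V] [AddCommGroup W]
    [Module ℚ V] (j : V →+ U) (hj : Function.Injective j) (e : V ≃+ V × W) :
    Nonempty (U ≃+ U × W) := by
  let _ : DivisibleBy V ℤ :=
    { div := fun v n => ((n : ℚ)⁻¹) • v
      div_zero := by intro a; simp
      div_cancel := by
        intro n a hn
        have : (n : ℚ) ≠ 0 := by exact_mod_cast hn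
        rw [← Int.cast_smul_eq_zsmul ℚ, smul_smul, mul_inv_cancel₀ this, one_smul] }
  obtain ⟨r, hr⟩ := (Module.Baer.of_divisible V).extension_property_addMonoidHom j hj
    (AddMonoidHom.id V)
  have hr' : ∀ v, r (j v) = v := fun v => DFunLike.congr_fun hr v
  let s : U ≃+ V × r.ker :=
    { toFun := fun u => (r u, ⟨u - j (r u), by simp [AddMonoidHom.mem_ker, hr']⟩)
      invFun := fun p => j p.1 + p.2
      left_inv := by intro u; simp
      right_inv := by
        rintro ⟨v, ⟨k, hk⟩⟩
        have hk' : r k = 0 := hk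
        simp [hr', hk']
      map_add' := by
        intro x y
        ext
        · simp
        · simp; abel }
  let t : U × W ≃+ (V × r.ker) × W := s.prodCongr (AddEquiv.refl W)
  refine ⟨s.trans (AddEquiv.trans (AddEquiv.prodCongr e (AddEquiv.refl _)) (AddEquiv.trans ?_ t.symm))⟩
  exact
    { toFun := fun p => ((p.1.1, p.2), p.1.2)
      invFun := fun p => ((p.1.1, p.2), p.1.2)
      left_inv := fun _ => rfl
      right_inv := fun _ => rfl
      map_add' := fun _ _ => rfl }

/-- The subgroup of infinitely divisible elements. -/
def divSub (U : Type) [AddCommGroup U] : AddSubgroup U where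
  carrier := {x | ∀ n : ℤ, n ≠ 0 → ∃ y, n • y = x}
  zero_mem' := fun n _ => ⟨0, by simp⟩
  add_mem' := by
    intro a b ha hb n hn
    obtain ⟨x, rfl⟩ := ha n hn
    obtain ⟨y, rfl⟩ := hb n hn
    exact ⟨x + y, by simp⟩
  neg_mem' := by
    intro a ha n hn
    obtain ⟨x, rfl⟩ := ha n hn
    exact ⟨-x, by simp⟩

theorem divSub_bij (U : Type) [AddCommGroup U]
    (ht : ∀ (n : ℤ) (x : U), n ≠ 0 → n • x = 0 → x = 0) (n : ℤ) (hn : n ≠ 0) :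
    Function.Bijective (fun x : divSub U => n • x) := by
  constructor
  · intro x y hxy
    have h1 : n • (x : U) = n • (y : U) := congrArg Subtype.val hxy
    apply Subtype.ext
    rw [← sub_eq_zero]
    apply ht n _ hn
    rw [smul_sub, h1, sub_self]
  · rintro ⟨x, hx⟩
    obtain ⟨y, hy⟩ := hx n hn
    refine ⟨⟨y, ?_⟩, Subtype.ext hy⟩
    intro m hm
    obtain ⟨z, hz⟩ := hx (n * m) (mul_ne_zero hn hm)
    refine ⟨z, ?_⟩
    rw [← sub_eq_zero]
    apply ht n _ hn
    rw [smul_sub, hy, ← hz, mul_smul, sub_self]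

/-- The ultrapower along the hyperfilter on the natural numbers. -/
abbrev nonstd (A : Type) : Type := Filter.Germ (Filter.hyperfilter ℕ : Filter ℕ) A

/-- The nonstandard factorial. -/
noncomputable def omegaFact : nonstd ℤ := ((fun k : ℕ => (k.factorial : ℤ) : ℕ → ℤ) : nonstd ℤ)

theorem omegaFact_mul_mem (a : nonstd ℤ) : omegaFact * a ∈ divSub (nonstd ℤ) := by
  intro n hn
  refine ⟨((fun k : ℕ => (k.factorial : ℤ) / n : ℕ → ℤ) : nonstd ℤ) * a, ?_⟩
  rw [← smul_mul_assoc]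
  congr 1
  apply Filter.Germ.coe_eq.mpr
  have : ∀ᶠ k : ℕ in (Filter.hyperfilter ℕ : Filter ℕ), n.natAbs ≤ k :=
    Filter.Eventually.filter_mono Nat.hyperfilter_le_atTop (Filter.eventually_ge_atTop _)
  filter_upwards [this] with k hk
  have hd : n ∣ (k.factorial : ℤ) := by
    rw [← Int.natAbs_dvd]
    exact_mod_cast Nat.dvd_factorial (Int.natAbs_pos.mpr hn) hk
  simp [Int.mul_ediv_cancel' hd]

theorem omegaFact_mul_inj (a b : nonstd ℤ) (h : omegaFact * a = omegaFact * b) : a = b := by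
  induction a using Filter.Germ.inductionOn with | _ f
  induction b using Filter.Germ.inductionOn with | _ g
  have h' := Filter.Germ.coe_eq.mp h
  apply Filter.Germ.coe_eq.mpr
  filter_upwards [h'] with k hk
  have : (k.factorial : ℤ) ≠ 0 := by exact_mod_cast k.factorial_ne_zero
  exact mul_left_cancel₀ this hk

theorem one_not_mem : (1 : nonstd ℤ) ∉ divSub (nonstd ℤ) := by
  intro h
  obtain ⟨y, hy⟩ := h 2 (by norm_num)
  induction y using Filter.Germ.inductionOn with | _ f
  have h' : (fun k => (2 : ℤ) • f k) =ᶠ[(Filter.hyperfilter ℕ : Filter ℕ)] fun _ => 1 :=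
    Filter.Germ.coe_eq.mp hy
  obtain ⟨k, hk⟩ := h'.exists
  simp at hk
  omega

theorem nonstd_torsion_free (n : ℤ) (x : nonstd ℤ) (hn : n ≠ 0) (h : n • x = 0) : x = 0 := by
  induction x using Filter.Germ.inductionOn with | _ f
  have h' : (fun k => n • f k) =ᶠ[(Filter.hyperfilter ℕ : Filter ℕ)] fun _ => 0 :=
    Filter.Germ.coe_eq.mp h
  apply Filter.Germ.coe_eq.mpr
  filter_upwards [h'] with k hk
  simpa [hn] using hk

theorem nonstd_absorb : Nonempty (nonstd ℤ ≃+ nonstd ℤ × nonstd ℚ) := by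
  obtain ⟨_⟩ := exists_rat_module (divSub (nonstd ℤ)) (divSub_bij _ nonstd_torsion_free)
  let m : divSub (nonstd ℤ) →+ divSub (nonstd ℤ) :=
    { toFun := fun x => ⟨omegaFact * x, omegaFact_mul_mem _⟩
      map_zero' := by ext; simp
      map_add' := by intro x y; ext; simp [mul_add] }
  have hfin : ¬ FiniteDimensional ℚ (divSub (nonstd ℤ)) := by
    intro hf
    have hi : Function.Injective m.toRatLinearMap := by
      intro x y hxy
      exact Subtype.ext (omegaFact_mul_inj _ _ (congrArg Subtype.val hxy))
    obtain ⟨x, hx⟩ := LinearMap.injective_iff_surjective.mp hi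
      ⟨omegaFact * 1, omegaFact_mul_mem 1⟩
    have := omegaFact_mul_inj _ _ (congrArg Subtype.val hx)
    exact one_not_mem (this ▸ x.2)
  have hcard : Cardinal.mk (nonstd ℚ) ≤ Cardinal.mk (divSub (nonstd ℤ)) := by
    obtain ⟨c⟩ : Nonempty (ℚ ≃ ℤ) := ⟨(Denumerable.eqv ℚ).trans (Denumerable.eqv ℤ).symm⟩
    refine Cardinal.mk_le_of_injective
      (f := fun q => ⟨omegaFact * Filter.Germ.map c q, omegaFact_mul_mem _⟩) ?_
    intro p q hpq
    have := omegaFact_mul_inj _ _ (congrArg Subtype.val hpq)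
    induction p using Filter.Germ.inductionOn with | _ f
    induction q using Filter.Germ.inductionOn with | _ g
    have h' := Filter.Germ.coe_eq.mp this
    apply Filter.Germ.coe_eq.mpr
    filter_upwards [h'] with k hk
    exact c.injective hk
  obtain ⟨e⟩ := absorb_rat_space _ _ hfin hcard
  exact split_absorb _ _ _ (divSub (nonstd ℤ)).subtype Subtype.val_injective e

theorem nonstd_prod (A B : Type) [AddCommGroup A] [AddCommGroup B] :
    Nonempty (nonstd (A × B) ≃+ nonstd A × nonstd B) := by
  let f : nonstd (A × B) →+ nonstd A × nonstd B :=
    { toFun := fun x => (x.map Prod.fst, x.map Prod.snd)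
      map_zero' := rfl
      map_add' := by
        intro x y
        induction x using Filter.Germ.inductionOn with | _ f
        induction y using Filter.Germ.inductionOn with | _ g
        rfl }
  refine ⟨AddEquiv.ofBijective f ⟨?_, ?_⟩⟩
  · intro x y h
    induction x using Filter.Germ.inductionOn with | _ x
    induction y using Filter.Germ.inductionOn with | _ y
    have h1 := Filter.Germ.coe_eq.mp (congrArg Prod.fst h)
    have h2 := Filter.Germ.coe_eq.mp (congrArg Prod.snd h)
    apply Filter.Germ.coe_eq.mpr
    filter_upwards [h1, h2] with k hk1 hk2
    exact Prod.ext hk1 hk2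
  · rintro ⟨x, y⟩
    induction x using Filter.Germ.inductionOn with | _ x
    induction y using Filter.Germ.inductionOn with | _ y
    exact ⟨((fun k => (x k, y k) : ℕ → A × B) : nonstd (A × B)), rfl⟩

/-- Group isomorphisms are isomorphisms of `Lgp`-structures. -/
def lgpEquivOfMulEquiv {G H : Type} [Group G] [Group H] (e : G ≃* H) : Lgp.Equiv G H where
  toEquiv := e.toEquiv
  map_fun' := by
    intro n f x
    cases f with
    | one => exact map_one e
    | inv => exact map_inv e _
    | mul => exact map_mul e _ _
  map_rel' := by
    intro n r x
    exact Empty.elim r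

theorem elem_equiv_nonstd (A : Type) [AddCommGroup A] :
    Lgp.ElementarilyEquivalent (Multiplicative A) (Multiplicative (nonstd A)) := by
  let P := (Filter.hyperfilter ℕ : Filter ℕ).Product (fun _ => Multiplicative A)
  have h1 : Lgp.ElementarilyEquivalent P (Multiplicative A) := by
    rw [Language.elementarilyEquivalent_iff]
    intro φ
    rw [Language.Ultraproduct.sentence_realize]
    simp
  let e : Lgp.Equiv P (Multiplicative (nonstd A)) :=
    { toEquiv := Equiv.refl _
      map_fun' := by
        intro n f x
        obtain ⟨y, rfl⟩ : ∃ y : Fin n → ℕ → Multiplicative A, x = fun i => (y i : P) :=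
          ⟨fun i => (x i).out, funext fun i => (Quotient.out_eq (x i)).symm⟩
        refine (Language.Ultraproduct.funMap_cast f y).trans ?_
        cases f <;> rfl
      map_rel' := by
        intro n r x
        exact Empty.elim r }
  exact h1.symm.trans (Language.StrongHomClass.elementarilyEquivalent e)

/-- The additive groups `ℤ` and `ℤ × ℚ` (written multiplicatively) are elementarily equivalent
in the first-order language of groups. -/
theorem Z_elementarily_equivalent_Z_times_Q :
    Lgp.ElementarilyEquivalent (Multiplicative ℤ) (Multiplicative (ℤ × ℚ)) := by
  obtain ⟨e⟩ := nonstd_absorb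
  obtain ⟨p⟩ := nonstd_prod ℤ ℚ
  have h := Language.StrongHomClass.elementarilyEquivalent (L := Lgp)
    (lgpEquivOfMulEquiv (e.trans p.symm).toMultiplicative)
  exact (elem_equiv_nonstd ℤ).trans (h.trans (elem_equiv_nonstd (ℤ × ℚ)).symm)
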